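/- Let X be a finite set with |X| ≥ 2, let P and Q be probability distributions on X with Q ≪ P, and let f : X → ℝ. Then √(V_{P,Q}(f)) ≤ √(2·V_Q(f)) + 3·span(f)·√(|X|·KL(Q,P)). -/

import Mathlib

open Finset

section Defs
variable {X : Type*} [Fintype X]

/-- `P` is a probability distribution on the finite set `X`. -/
def IsDist (P : X → ℝ) : Prop := (∀ x, 0 ≤ P x) ∧ ∑ x, P x = 1

/-- `Q ≪ P`: absolute continuity. -/
def AbsCont (Q P : X → ℝ) : Prop := ∀ x, P x = 0 → Q x = 0

/-- Mean of `f` under `P`. -/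
noncomputable def distMean (P f : X → ℝ) : ℝ := ∑ x, P x * f x

/-- Variance of `f` under `P`. -/
noncomputable def distVar (P f : X → ℝ) : ℝ := ∑ x, P x * (f x - distMean P f) ^ 2

/-- Kullback-Leibler divergence `KL(Q,P)`. -/
noncomputable def distKL (Q P : X → ℝ) : ℝ :=
  ∑ x, if 0 < Q x then Q x * Real.log (Q x / P x) else 0

/-- The local variance `V_{P,Q}(f) = ∑_{x : P(x) ≥ Q(x)} P(x) (f(x) - E_P f)^2`. -/
noncomputable def Vloc (P Q f : X → ℝ) : ℝ :=
  ∑ x, if Q x ≤ P x then P x * (f x - distMean P f) ^ 2 else 0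

/-- Span of `f`: `max f - min f`. -/
noncomputable def distSpan [Nonempty X] (f : X → ℝ) : ℝ :=
  univ.sup' univ_nonempty f - univ.inf' univ_nonempty f

end Defs

/-- Minkowski's inequality for finite families of reals. -/
theorem sqrt_sum_add_sq_le {ι : Type*} [Fintype ι] (u v : ι → ℝ) :
    Real.sqrt (∑ i, (u i + v i) ^ 2) ≤
      Real.sqrt (∑ i, u i ^ 2) + Real.sqrt (∑ i, v i ^ 2) := by
  have h := norm_add_le (WithLp.toLp 2 u : EuclideanSpace ℝ ι) (WithLp.toLp 2 v)
  simpa [EuclideanSpace.norm_eq] using h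

/-- The logarithmic inequality behind the comparison of Hellinger distance and divergence. -/
theorem two_mul_sub_two_mul_sqrt_le {p q : ℝ} (hp : 0 ≤ p) (hq : 0 ≤ q) (hqp : p = 0 → q = 0) :
    2 * q - 2 * (Real.sqrt p * Real.sqrt q) ≤
      if 0 < q then q * Real.log (q / p) else 0 := by
  split_ifs with h
  · have hp' : 0 < p := hp.lt_of_ne fun h0 => h.ne' (hqp h0.symm)
    have hsp := Real.sqrt_pos.2 hp'
    have hsq := Real.sqrt_pos.2 h
    have h1 := Real.log_le_sub_one_of_pos (div_pos hsp hsq)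
    have h2 : Real.log (q / p) = -2 * Real.log (Real.sqrt p / Real.sqrt q) := by
      rw [Real.log_div h.ne' hp'.ne', Real.log_div hsp.ne' hsq.ne', Real.log_sqrt hp,
        Real.log_sqrt hq]
      ring
    have h3 : q * (Real.sqrt p / Real.sqrt q) = Real.sqrt p * Real.sqrt q := by
      rw [mul_div_assoc', div_eq_iff hsq.ne', mul_assoc, Real.mul_self_sqrt hq, mul_comm]
    rw [h2]
    have h4 := mul_le_mul_of_nonneg_left h1 hq
    rw [mul_sub, h3] at h4
    linarith
  · simp [le_antisymm (not_lt.1 h) hq]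

/-- The squared Hellinger distance is at most the Kullback-Leibler divergence. -/
theorem sum_sqrt_sub_sqrt_sq_le_distKL {X : Type*} [Fintype X] {P Q : X → ℝ}
    (hP : IsDist P) (hQ : IsDist Q) (hQP : AbsCont Q P) :
    ∑ x, (Real.sqrt (P x) - Real.sqrt (Q x)) ^ 2 ≤ distKL Q P := by
  have h1 : ∑ x, (Real.sqrt (P x) - Real.sqrt (Q x)) ^ 2 =
      ∑ x, ((P x - Q x) + (2 * Q x - 2 * (Real.sqrt (P x) * Real.sqrt (Q x)))) :=
    sum_congr rfl fun x _ => by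
      rw [sub_sq, Real.sq_sqrt (hP.1 x), Real.sq_sqrt (hQ.1 x)]
      ring
  rw [h1, sum_add_distrib, sum_sub_distrib, hP.2, hQ.2, sub_self, zero_add]
  exact sum_le_sum fun x _ => two_mul_sub_two_mul_sqrt_le (hP.1 x) (hQ.1 x) (hQP x)

theorem distSpan_nonneg {X : Type*} [Fintype X] [Nonempty X] (f : X → ℝ) : 0 ≤ distSpan f := by
  obtain ⟨x⟩ := ‹Nonempty X›
  exact sub_nonneg.2 ((inf'_le f (mem_univ x)).trans (le_sup' f (mem_univ x)))

theorem abs_sub_distMean_le {X : Type*} [Fintype X] [Nonempty X] {Q : X → ℝ} (hQ : IsDist Q)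
    (f : X → ℝ) (x : X) : |f x - distMean Q f| ≤ distSpan f := by
  have hu : distMean Q f ≤ univ.sup' univ_nonempty f := by
    calc distMean Q f ≤ ∑ y, Q y * univ.sup' univ_nonempty f :=
          sum_le_sum fun y _ => mul_le_mul_of_nonneg_left (le_sup' f (mem_univ y)) (hQ.1 y)
      _ = _ := by rw [← sum_mul, hQ.2, one_mul]
  have hl : univ.inf' univ_nonempty f ≤ distMean Q f := by
    calc univ.inf' univ_nonempty f = ∑ y, Q y * univ.inf' univ_nonempty f := by
          rw [← sum_mul, hQ.2, one_mul]
      _ ≤ _ := sum_le_sum fun y _ => mul_le_mul_of_nonneg_left (inf'_le f (mem_univ y)) (hQ.1 y)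
  have h1 := le_sup' f (mem_univ x)
  have h2 := inf'_le f (mem_univ x)
  unfold distSpan
  rw [abs_le]
  constructor <;> linarith

theorem sq_sub_distMean_le {X : Type*} [Fintype X] [Nonempty X] {Q : X → ℝ} (hQ : IsDist Q)
    (f : X → ℝ) (x : X) : (f x - distMean Q f) ^ 2 ≤ distSpan f ^ 2 :=
  sq_le_sq' (abs_le.1 (abs_sub_distMean_le hQ f x)).1 (abs_le.1 (abs_sub_distMean_le hQ f x)).2

/-- Means under two distributions differ by at most twice the span times the Hellinger
distance. -/
theorem sq_distMean_sub_distMean_le {X : Type*} [Fintype X] [Nonempty X] {P Q : X → ℝ}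
    (hP : IsDist P) (hQ : IsDist Q) (f : X → ℝ) :
    (distMean Q f - distMean P f) ^ 2 ≤
      (2 * distSpan f) ^ 2 * ∑ x, (Real.sqrt (P x) - Real.sqrt (Q x)) ^ 2 := by
  have h1 : distMean P f - distMean Q f = ∑ x, (Real.sqrt (P x) - Real.sqrt (Q x)) *
      ((Real.sqrt (P x) + Real.sqrt (Q x)) * (f x - distMean Q f)) := by
    have h : ∀ x, (Real.sqrt (P x) - Real.sqrt (Q x)) *
        ((Real.sqrt (P x) + Real.sqrt (Q x)) * (f x - distMean Q f)) =
        (P x * f x - Q x * f x) - (P x - Q x) * distMean Q f := fun x => by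
      have hp := Real.sq_sqrt (hP.1 x)
      have hq := Real.sq_sqrt (hQ.1 x)
      linear_combination (f x - distMean Q f) * hp - (f x - distMean Q f) * hq
    simp_rw [h]
    rw [sum_sub_distrib, sum_sub_distrib, ← sum_mul, sum_sub_distrib, hP.2, hQ.2, sub_self,
      zero_mul, sub_zero]
    rfl
  have h2 : ∑ x, ((Real.sqrt (P x) + Real.sqrt (Q x)) * (f x - distMean Q f)) ^ 2 ≤
      (2 * distSpan f) ^ 2 := by
    calc _ ≤ ∑ x, (2 * (P x + Q x)) * distSpan f ^ 2 := sum_le_sum fun x _ => by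
          rw [mul_pow]
          refine mul_le_mul ?_ (sq_sub_distMean_le hQ f x) (sq_nonneg _)
            (mul_nonneg zero_le_two (add_nonneg (hP.1 x) (hQ.1 x)))
          nlinarith [Real.sq_sqrt (hP.1 x), Real.sq_sqrt (hQ.1 x),
            sq_nonneg (Real.sqrt (P x) - Real.sqrt (Q x))]
      _ = _ := by
          rw [← sum_mul, ← mul_sum, sum_add_distrib, hP.2, hQ.2]
          ring
  rw [← neg_sub, neg_sq, h1, mul_comm]
  exact (sum_mul_sq_le_sq_mul_sq _ _ _).trans
    (mul_le_mul_of_nonneg_left h2 (sum_nonneg fun x _ => sq_nonneg _))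

/-- A dimension-free bound on the local variance. -/
theorem sqrt_Vloc_le_sqrt_distVar_add {X : Type*} [Fintype X] [Nonempty X] {P Q : X → ℝ}
    (hP : IsDist P) (hQ : IsDist Q) (hQP : AbsCont Q P) (f : X → ℝ) :
    Real.sqrt (Vloc P Q f) ≤
      Real.sqrt (distVar Q f) + 3 * distSpan f * Real.sqrt (distKL Q P) := by
  have hS := distSpan_nonneg f
  have hKL := sum_sqrt_sub_sqrt_sq_le_distKL hP hQ hQP
  set u : X → ℝ := fun x => if Q x ≤ P x then Real.sqrt (Q x) * (f x - distMean Q f) else 0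
    with hu
  set v : X → ℝ := fun x => if Q x ≤ P x then
    (Real.sqrt (P x) - Real.sqrt (Q x)) * (f x - distMean Q f) else 0 with hv
  set w : X → ℝ := fun x => if Q x ≤ P x then
    Real.sqrt (P x) * (distMean Q f - distMean P f) else 0 with hw
  have hV : Vloc P Q f = ∑ x, (u x + v x + w x) ^ 2 := by
    refine sum_congr rfl fun x _ => ?_
    simp only [hu, hv, hw]
    split_ifs
    · linear_combination -(f x - distMean P f) ^ 2 * Real.sq_sqrt (hP.1 x)
    · simp
  have h1 : ∑ x, u x ^ 2 ≤ distVar Q f := sum_le_sum fun x _ => by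
    simp only [hu]
    split_ifs
    · rw [mul_pow, Real.sq_sqrt (hQ.1 x)]
    · simpa using mul_nonneg (hQ.1 x) (sq_nonneg (f x - distMean Q f))
  have h2 : ∑ x, v x ^ 2 ≤ distSpan f ^ 2 * distKL Q P := by
    refine le_trans ?_ (mul_le_mul_of_nonneg_left hKL (sq_nonneg _))
    rw [mul_sum]
    refine sum_le_sum fun x _ => ?_
    simp only [hv]
    split_ifs
    · rw [mul_pow, mul_comm]
      exact mul_le_mul_of_nonneg_right (sq_sub_distMean_le hQ f x) (sq_nonneg _)
    · rw [zero_pow two_ne_zero]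
      positivity
  have h3 : ∑ x, w x ^ 2 ≤ (2 * distSpan f) ^ 2 * distKL Q P := by
    calc ∑ x, w x ^ 2 ≤ ∑ x, P x * (distMean Q f - distMean P f) ^ 2 :=
          sum_le_sum fun x _ => by
            simp only [hw]
            split_ifs
            · rw [mul_pow, Real.sq_sqrt (hP.1 x)]
            · simpa using mul_nonneg (hP.1 x) (sq_nonneg (distMean Q f - distMean P f))
      _ = (distMean Q f - distMean P f) ^ 2 := by rw [← sum_mul, hP.2, one_mul]
      _ ≤ _ := sq_distMean_sub_distMean_le hP hQ f
      _ ≤ _ := mul_le_mul_of_nonneg_left hKL (sq_nonneg _)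
  have h2' := Real.sqrt_le_sqrt h2
  have h3' := Real.sqrt_le_sqrt h3
  rw [Real.sqrt_mul (sq_nonneg _), Real.sqrt_sq (by positivity)] at h2' h3'
  rw [hV]
  linarith [sqrt_sum_add_sq_le (fun x => u x + v x) w, sqrt_sum_add_sq_le u v,
    Real.sqrt_le_sqrt h1]

/-- For `|X| ≥ 2` and `Q ≪ P`,
`√(V_{P,Q}(f)) ≤ √(2 V_Q(f)) + 3 span(f) √(|X| KL(Q,P))`. -/
theorem sqrt_Vloc_le {X : Type*} [Fintype X] [Nonempty X]
    (hcard : 2 ≤ Fintype.card X)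
    (P Q : X → ℝ) (hP : IsDist P) (hQ : IsDist Q) (hQP : AbsCont Q P) (f : X → ℝ) :
    Real.sqrt (Vloc P Q f) ≤
      Real.sqrt (2 * distVar Q f)
        + 3 * distSpan f * Real.sqrt ((Fintype.card X : ℝ) * distKL Q P) := by
  have hS := distSpan_nonneg f
  have hKL : 0 ≤ distKL Q P :=
    (sum_nonneg fun x _ => sq_nonneg _).trans (sum_sqrt_sub_sqrt_sq_le_distKL hP hQ hQP)
  have hVar : 0 ≤ distVar Q f := sum_nonneg fun x _ => mul_nonneg (hQ.1 x) (sq_nonneg _)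
  have hc : (1 : ℝ) ≤ Fintype.card X := by exact_mod_cast one_le_two.trans hcard
  refine (sqrt_Vloc_le_sqrt_distVar_add hP hQ hQP f).trans ?_
  gcongr
  · linarith
  · exact le_mul_of_one_le_left hKL hc
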